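/- arXiv:1803.02448 — 3 statements merged into one kernel-verified Lean document; each statement's English description precedes it below -/
import Mathlib

section
/- Let Ω ⊆ ℝ² be open, let H ∈ C¹(ℝ^m,ℝ^m) with ∂_iH_j = ∂_jH_i for all i,j, and let u = (u_1,…,u_m), u_i ∈ C²(Ω), solve Δ_G u_i = H_i(u) in Ω. Suppose u is pointwise-stable: there exist φ_1,…,φ_m ∈ C³(Ω), each nowhere vanishing and of constant sign, with Δ_G φ_i = Σ_{j=1}^m ∂_jH_i(u)·φ_j in Ω for every i, and (when m ≥ 2) ∂_jH_i(u)·φ_i·φ_j < 0 in Ω for all i ≠ j. Then for all ζ_1,…,ζ_m ∈ C¹(Ω) with compact support in Ω, −Σ_{i,j=1}^m ∫_Ω ∂_iH_j(u)·ζ_i·ζ_j dxdy ≤ Σ_{i=1}^m ∫_Ω ((Xζ_i)² + (Yζ_i)²) dxdy. -/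
open MeasureTheory Real Filter

/-- Partial derivative in the `x`-variable. -/
noncomputable def pdx (u : ℝ × ℝ → ℝ) (p : ℝ × ℝ) : ℝ :=
  deriv (fun t => u (t, p.2)) p.1

/-- Partial derivative in the `y`-variable. -/
noncomputable def pdy (u : ℝ × ℝ → ℝ) (p : ℝ × ℝ) : ℝ :=
  deriv (fun t => u (p.1, t)) p.2

/-- The Grushin vector field `X u = ∂ₓ u`. -/
noncomputable def Xg (u : ℝ × ℝ → ℝ) (p : ℝ × ℝ) : ℝ := pdx u p

/-- The Grushin vector field `Y u = x·∂_y u`. -/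
noncomputable def Yg (u : ℝ × ℝ → ℝ) (p : ℝ × ℝ) : ℝ := p.1 * pdy u p

/-- The commutator field `Z u = ∂_y u`. -/
noncomputable def Zg (u : ℝ × ℝ → ℝ) (p : ℝ × ℝ) : ℝ := pdy u p

/-- The Grushin Laplacian `Δ_G u = X(Xu) + Y(Yu)`. -/
noncomputable def deltaG (u : ℝ × ℝ → ℝ) (p : ℝ × ℝ) : ℝ := Xg (Xg u) p + Yg (Yg u) p

/-- The norm of the Grushin gradient, `|∇_G u| = √((Xu)² + (Yu)²)`. -/
noncomputable def normG (u : ℝ × ℝ → ℝ) (p : ℝ × ℝ) : ℝ :=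
  Real.sqrt ((Xg u p) ^ 2 + (Yg u p) ^ 2)

/-- The `j`-th partial derivative of a function `H : ℝ^m → ℝ`. -/
noncomputable def pdH {m : ℕ} (H : (Fin m → ℝ) → ℝ) (j : Fin m) (v : Fin m → ℝ) : ℝ :=
  fderiv ℝ H v (Pi.single j 1)

/-- Intrinsic curvature `𝒜` of the level sets. -/
noncomputable def curvA (u : ℝ × ℝ → ℝ) (p : ℝ × ℝ) : ℝ :=
  ((normG u p) ^ 3)⁻¹ *
    (Xg (Xg u) p * (Yg u p) ^ 2 - Xg (Yg u) p * Xg u p * Yg u p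
      - Yg (Xg u) p * Xg u p * Yg u p + Yg (Yg u) p * (Xg u p) ^ 2)

/-- Intrinsic tangential quantity `ℬ` of the level sets. -/
noncomputable def curvB (u : ℝ × ℝ → ℝ) (p : ℝ × ℝ) : ℝ :=
  ((normG u p) ^ 3)⁻¹ *
    (Xg (Xg u) p * Xg u p * Yg u p - Xg (Yg u) p * (Xg u p) ^ 2
      + Yg (Xg u) p * (Yg u p) ^ 2 - Yg (Yg u) p * Xg u p * Yg u p)

/-- The Grushin ball `B_R = {(x,y) : x⁴ + y² < R⁴}`. -/
def ballG (R : ℝ) : Set (ℝ × ℝ) := {p : ℝ × ℝ | p.1 ^ 4 + p.2 ^ 2 < R ^ 4}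

/-- The Grushin norm `‖(x,y)‖_G = (x⁴+y²)^(1/4)`. -/
noncomputable def grushinNorm (p : ℝ × ℝ) : ℝ := (p.1 ^ 4 + p.2 ^ 2) ^ ((1 : ℝ) / 4)

/-- A `C^n` function on an open set becomes globally `C^n` after multiplication by a `C^n` function
supported in that set. -/
lemma contDiff_mul_of_tsupport_subset {n : WithTop ℕ∞} {Ω : Set (ℝ × ℝ)} (hΩ : IsOpen Ω)
    {z f : ℝ × ℝ → ℝ} (hz : ContDiff ℝ n z) (hzΩ : tsupport z ⊆ Ω) (hf : ContDiffOn ℝ n f Ω) :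
    ContDiff ℝ n (fun p => z p * f p) := by
  refine contDiff_iff_contDiffAt.2 fun p => ?_
  by_cases hp : p ∈ tsupport z
  · exact hz.contDiffAt.mul (hf.contDiffAt (hΩ.mem_nhds (hzΩ hp)))
  · refine (contDiffAt_const (c := (0 : ℝ))).congr_of_eventuallyEq ?_
    filter_upwards [notMem_tsupport_iff_eventuallyEq.1 hp] with q hq
    simp [hq]

lemma hasDerivAt_pdx {f : ℝ × ℝ → ℝ} {p : ℝ × ℝ} (hf : DifferentiableAt ℝ f p) :
    HasDerivAt (fun t => f (t, p.2)) (pdx f p) p.1 := by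
  have h : DifferentiableAt ℝ (fun t : ℝ => f (t, p.2)) p.1 :=
    DifferentiableAt.comp (g := f) p.1 hf (by fun_prop)
  exact h.hasDerivAt

lemma hasDerivAt_pdy {f : ℝ × ℝ → ℝ} {p : ℝ × ℝ} (hf : DifferentiableAt ℝ f p) :
    HasDerivAt (fun t => f (p.1, t)) (pdy f p) p.2 := by
  have h : DifferentiableAt ℝ (fun t : ℝ => f (p.1, t)) p.2 :=
    DifferentiableAt.comp (g := f) p.2 hf (by fun_prop)
  exact h.hasDerivAt

lemma pdx_eq_fderiv {f : ℝ × ℝ → ℝ} {p : ℝ × ℝ} (hf : DifferentiableAt ℝ f p) :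
    pdx f p = fderiv ℝ f p (1, 0) := by
  have h : HasDerivAt (fun t : ℝ => (t, p.2)) ((1 : ℝ), (0 : ℝ)) p.1 :=
    (hasDerivAt_id p.1).prodMk (hasDerivAt_const p.1 p.2)
  exact (HasFDerivAt.comp_hasDerivAt (l := f) p.1 hf.hasFDerivAt h).deriv

lemma pdy_eq_fderiv {f : ℝ × ℝ → ℝ} {p : ℝ × ℝ} (hf : DifferentiableAt ℝ f p) :
    pdy f p = fderiv ℝ f p (0, 1) := by
  have h : HasDerivAt (fun t : ℝ => (p.1, t)) ((0 : ℝ), (1 : ℝ)) p.2 :=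
    (hasDerivAt_const p.2 p.1).prodMk (hasDerivAt_id p.2)
  exact (HasFDerivAt.comp_hasDerivAt (l := f) p.2 hf.hasFDerivAt h).deriv

lemma ContDiffOn.fderiv_apply_of_isOpen {n : WithTop ℕ∞} {Ω : Set (ℝ × ℝ)} (hΩ : IsOpen Ω)
    {f : ℝ × ℝ → ℝ} (hf : ContDiffOn ℝ (n + 1) f Ω) (v : ℝ × ℝ) :
    ContDiffOn ℝ n (fun p => fderiv ℝ f p v) Ω :=
  (hf.fderiv_of_isOpen hΩ le_rfl).clm_apply contDiffOn_const

lemma ContDiffOn.Xg {n : WithTop ℕ∞} {Ω : Set (ℝ × ℝ)} (hΩ : IsOpen Ω) {f : ℝ × ℝ → ℝ}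
    (hf : ContDiffOn ℝ (n + 1) f Ω) : ContDiffOn ℝ n (Xg f) Ω :=
  (ContDiffOn.fderiv_apply_of_isOpen hΩ hf (1, 0)).congr fun p hp =>
    pdx_eq_fderiv ((hf.contDiffAt (hΩ.mem_nhds hp)).differentiableAt (by simp))

lemma ContDiffOn.Yg {n : WithTop ℕ∞} {Ω : Set (ℝ × ℝ)} (hΩ : IsOpen Ω) {f : ℝ × ℝ → ℝ}
    (hf : ContDiffOn ℝ (n + 1) f Ω) : ContDiffOn ℝ n (Yg f) Ω :=
  (contDiffOn_fst.mul (ContDiffOn.fderiv_apply_of_isOpen hΩ hf (0, 1))).congr fun p hp =>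
    congrArg (p.1 * ·)
      (pdy_eq_fderiv ((hf.contDiffAt (hΩ.mem_nhds hp)).differentiableAt (by simp)))

/-- The integral of a directional derivative of a compactly supported `C¹` function vanishes. -/
lemma integral_fderiv_apply_eq_zero {f : ℝ × ℝ → ℝ} (hf : ContDiff ℝ 1 f)
    (hc : HasCompactSupport f) (v : ℝ × ℝ) : ∫ p, fderiv ℝ f p v = 0 := by
  have hd : Integrable (fun p => fderiv ℝ f p v) :=
    ((hf.continuous_fderiv one_ne_zero).clm_apply continuous_const).integrable_of_hasCompactSupport
      (hc.fderiv_apply (𝕜 := ℝ) v)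
  have h := integral_mul_fderiv_eq_neg_fderiv_mul_of_integrable (μ := (volume : Measure (ℝ × ℝ)))
    (f := fun _ : ℝ × ℝ => (1 : ℝ)) (g := f) (v := v) (by simp) (by simpa using hd)
    (by simpa using hf.continuous.integrable_of_hasCompactSupport hc)
    (fun _ _ => differentiableAt_const _) (fun p _ => hf.differentiable one_ne_zero p)
  simpa using h

lemma HasDerivAt.mul_mul_inv_mul {z f g : ℝ → ℝ} {z' f' g' t : ℝ} (hz : HasDerivAt z z' t)
    (hf : HasDerivAt f f' t) (hg : HasDerivAt g g' t) (h0 : f t ≠ 0) :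
    HasDerivAt (fun s => z s * (z s * (f s)⁻¹ * g s))
      (2 * z t * z' * (f t)⁻¹ * g t - z t ^ 2 * (f t)⁻¹ ^ 2 * f' * g t
        + z t ^ 2 * (f t)⁻¹ * g') t := by
  refine (hz.mul ((hz.mul (hf.inv h0)).mul hg)).congr_deriv ?_
  simp only [Pi.mul_apply, Pi.inv_apply]
  field_simp
  ring

/-- A divergence term with zero integral that bounds `|∇_G z|² + z² (Δ_G f) / f` from below. -/
lemma exists_le_normG_sq_add {Ω : Set (ℝ × ℝ)} (hΩ : IsOpen Ω) {z f : ℝ × ℝ → ℝ}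
    (hz : ContDiff ℝ 1 z) (hzc : HasCompactSupport z) (hzΩ : tsupport z ⊆ Ω)
    (hf : ContDiffOn ℝ 3 f Ω) (hf0 : ∀ p ∈ Ω, f p ≠ 0) :
    ∃ D : ℝ × ℝ → ℝ, IntegrableOn D Ω ∧ ∫ p in Ω, D p = 0 ∧
      ∀ p ∈ Ω, D p ≤ Xg z p ^ 2 + Yg z p ^ 2 + z p ^ 2 * (f p)⁻¹ * deltaG f p := by
  have hX : ContDiffOn ℝ 2 (Xg f) Ω := ContDiffOn.Xg (n := 2) hΩ hf
  have hY : ContDiffOn ℝ 2 (Yg f) Ω := ContDiffOn.Yg (n := 2) hΩ hf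
  have hi : ContDiffOn ℝ 1 (fun p => (f p)⁻¹) Ω :=
    (hf.inv hf0).of_le (by norm_num)
  set F : ℝ × ℝ → ℝ := fun p => z p * (z p * (f p)⁻¹ * Xg f p) with hF
  set G : ℝ × ℝ → ℝ := fun p => z p * (z p * (f p)⁻¹ * (p.1 * Yg f p)) with hG
  have hF1 : ContDiff ℝ 1 F := contDiff_mul_of_tsupport_subset hΩ hz hzΩ
    ((hz.contDiffOn.mul hi).mul (hX.of_le (by norm_num)))
  have hG1 : ContDiff ℝ 1 G := contDiff_mul_of_tsupport_subset hΩ hz hzΩ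
    ((hz.contDiffOn.mul hi).mul (contDiffOn_fst.mul (hY.of_le (by norm_num))))
  have hFc : HasCompactSupport F := hzc.mul_right
  have hGc : HasCompactSupport G := hzc.mul_right
  have hFs : tsupport F ⊆ Ω := tsupport_mul_subset_left.trans hzΩ
  have hGs : tsupport G ⊆ Ω := tsupport_mul_subset_left.trans hzΩ
  have hFi : Integrable (fun p => fderiv ℝ F p (1, 0)) :=
    ((hF1.continuous_fderiv one_ne_zero).clm_apply continuous_const).integrable_of_hasCompactSupport
      (hFc.fderiv_apply (𝕜 := ℝ) _)
  have hGi : Integrable (fun p => fderiv ℝ G p (0, 1)) :=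
    ((hG1.continuous_fderiv one_ne_zero).clm_apply continuous_const).integrable_of_hasCompactSupport
      (hGc.fderiv_apply (𝕜 := ℝ) _)
  refine ⟨fun p => fderiv ℝ F p (1, 0) + fderiv ℝ G p (0, 1), (hFi.add hGi).integrableOn, ?_, ?_⟩
  · rw [setIntegral_eq_integral_of_forall_compl_eq_zero, integral_add hFi hGi,
      integral_fderiv_apply_eq_zero hF1 hFc, integral_fderiv_apply_eq_zero hG1 hGc, add_zero]
    intro p hp
    rw [fderiv_of_notMem_tsupport ℝ (fun h => hp (hFs h)),
      fderiv_of_notMem_tsupport ℝ (fun h => hp (hGs h))]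
    simp
  · intro p hp
    have hn := hΩ.mem_nhds hp
    have hzd : DifferentiableAt ℝ z p := hz.differentiable one_ne_zero p
    have hfd : DifferentiableAt ℝ f p := (hf.contDiffAt hn).differentiableAt (by norm_num)
    have hXd : DifferentiableAt ℝ (Xg f) p := (hX.contDiffAt hn).differentiableAt (by norm_num)
    have hYd : DifferentiableAt ℝ (Yg f) p := (hY.contDiffAt hn).differentiableAt (by norm_num)
    have e1 : fderiv ℝ F p (1, 0) = _ :=
      (pdx_eq_fderiv (hF1.differentiable one_ne_zero p)).symm.trans
        ((hasDerivAt_pdx hzd).mul_mul_inv_mul (hasDerivAt_pdx hfd) (hasDerivAt_pdx hXd)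
          (hf0 p hp)).deriv
    have e2 : fderiv ℝ G p (0, 1) = _ :=
      (pdy_eq_fderiv (hG1.differentiable one_ne_zero p)).symm.trans
        ((hasDerivAt_pdy hzd).mul_mul_inv_mul (hasDerivAt_pdy hfd)
          ((hasDerivAt_pdy hYd).const_mul p.1) (hf0 p hp)).deriv
    simp only [e1, e2, deltaG]
    simp only [Xg, Yg]
    nlinarith [sq_nonneg (pdx z p - z p * (f p)⁻¹ * pdx f p),
      sq_nonneg (p.1 * pdy z p - z p * (f p)⁻¹ * (p.1 * pdy f p))]

/-- The quadratic form of a symmetric matrix whose off-diagonal entries satisfy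
`A i j * w i * w j < 0` dominates `∑ i, z i ^ 2 * (A w) i / w i`. -/
lemma sum_sq_mul_inv_mul_sum_le {ι : Type*} [Fintype ι] (A : ι → ι → ℝ) (z w : ι → ℝ)
    (hA : ∀ i j, A i j = A j i) (hw : ∀ i, w i ≠ 0)
    (hneg : ∀ i j, i ≠ j → A i j * w i * w j < 0) :
    ∑ i, z i ^ 2 * (w i)⁻¹ * ∑ j, A i j * w j ≤ ∑ i, ∑ j, A i j * z i * z j := by
  have hswap : ∑ i, ∑ j, z i ^ 2 * (w i)⁻¹ * (A i j * w j) =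
      ∑ i, ∑ j, z j ^ 2 * (w j)⁻¹ * (A i j * w i) := by
    rw [Finset.sum_comm]
    exact Finset.sum_congr rfl fun i _ => Finset.sum_congr rfl fun j _ => by rw [hA]
  have hle : ∑ i, ∑ j, (z i ^ 2 * (w i)⁻¹ * (A i j * w j) + z j ^ 2 * (w j)⁻¹ * (A i j * w i)) ≤
      ∑ i, ∑ j, 2 * (A i j * z i * z j) := by
    refine Finset.sum_le_sum fun i _ => Finset.sum_le_sum fun j _ => ?_
    have hi := hw i
    have hj := hw j
    have key : z i ^ 2 * (w i)⁻¹ * (A i j * w j) + z j ^ 2 * (w j)⁻¹ * (A i j * w i)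
        - 2 * (A i j * z i * z j) = A i j * w i * w j * (z i / w i - z j / w j) ^ 2 := by
      field_simp
      ring
    rcases eq_or_ne i j with rfl | hij
    · simp at key
      linarith
    · have := mul_nonpos_of_nonpos_of_nonneg (hneg i j hij).le (sq_nonneg (z i / w i - z j / w j))
      linarith
  simp only [Finset.sum_add_distrib, ← hswap, ← Finset.mul_sum] at hle
  linarith

/-- Stability inequality for pointwise-stable solutions of the
symmetric Grushin system on an open set `Ω ⊆ ℝ²`. -/
theorem stmt_2 {m : ℕ} (Ω : Set (ℝ × ℝ)) (hΩ : IsOpen Ω)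
    (H : Fin m → (Fin m → ℝ) → ℝ) (hH : ∀ i, ContDiff ℝ 1 (H i))
    (hsymm : ∀ i j v, pdH (H j) i v = pdH (H i) j v)
    (u : Fin m → ℝ × ℝ → ℝ) (hu : ∀ i, ContDiffOn ℝ 2 (u i) Ω)
    (hsys : ∀ i, ∀ p ∈ Ω, deltaG (u i) p = H i (fun j => u j p))
    -- pointwise stability: a nowhere-vanishing constant-sign solution of the linearized system
    (hstab : ∃ φ : Fin m → ℝ × ℝ → ℝ,
      (∀ i, ContDiffOn ℝ 3 (φ i) Ω) ∧
      (∀ i, (∀ p ∈ Ω, 0 < φ i p) ∨ (∀ p ∈ Ω, φ i p < 0)) ∧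
      (∀ i, ∀ p ∈ Ω, deltaG (φ i) p = ∑ j, pdH (H i) j (fun k => u k p) * φ j p) ∧
      (∀ i j, i ≠ j → ∀ p ∈ Ω, pdH (H i) j (fun k => u k p) * φ i p * φ j p < 0))
    (ζ : Fin m → ℝ × ℝ → ℝ) (hζ : ∀ i, ContDiff ℝ 1 (ζ i))
    (hζc : ∀ i, HasCompactSupport (ζ i)) (hζΩ : ∀ i, tsupport (ζ i) ⊆ Ω) :
    (-(∑ i, ∑ j, ∫ p in Ω, pdH (H j) i (fun k => u k p) * ζ i p * ζ j p))
      ≤ ∑ i, ∫ p in Ω, ((Xg (ζ i) p) ^ 2 + (Yg (ζ i) p) ^ 2) := by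
  obtain ⟨φ, hφ, hsign, hlin, hneg⟩ := hstab
  have hφ0 : ∀ i, ∀ p ∈ Ω, φ i p ≠ 0 := fun i p hp =>
    (hsign i).elim (fun h => (h p hp).ne') (fun h => (h p hp).ne)
  choose D hDi hD0 hDle using fun i =>
    exists_le_normG_sq_add hΩ (hζ i) (hζc i) (hζΩ i) (hφ i) (hφ0 i)
  have huc : ContinuousOn (fun p => fun k => u k p) Ω :=
    continuousOn_pi.2 fun k => (hu k).continuousOn
  have hquad : ∀ i j, IntegrableOn
      (fun p => pdH (H j) i (fun k => u k p) * ζ i p * ζ j p) Ω := by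
    intro i j
    have hpd : Continuous (pdH (H j) i) :=
      ((hH j).continuous_fderiv one_ne_zero).clm_apply continuous_const
    have hc : ContDiff ℝ 0 (fun p => ζ i p * (pdH (H j) i (fun k => u k p) * ζ j p)) :=
      contDiff_mul_of_tsupport_subset hΩ ((hζ i).of_le zero_le_one) (hζΩ i)
        (contDiffOn_zero.2 ((hpd.comp_continuousOn huc).mul (hζ j).continuous.continuousOn))
    refine ((hc.continuous.integrable_of_hasCompactSupport (hζc i).mul_right).congr
      (.of_forall fun p => ?_)).integrableOn
    ring
  have hgrad : ∀ i, IntegrableOn (fun p => Xg (ζ i) p ^ 2 + Yg (ζ i) p ^ 2) Ω := by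
    intro i
    have hd : ∀ p, DifferentiableAt ℝ (ζ i) p := (hζ i).differentiable one_ne_zero
    have hfd : ∀ v, Continuous (fun p => fderiv ℝ (ζ i) p v) := fun v =>
      ((hζ i).continuous_fderiv one_ne_zero).clm_apply continuous_const
    have hXY : (fun p => Xg (ζ i) p ^ 2 + Yg (ζ i) p ^ 2) =
        fun p => fderiv ℝ (ζ i) p (1, 0) ^ 2 + (p.1 * fderiv ℝ (ζ i) p (0, 1)) ^ 2 := by
      funext p
      simp only [Xg, Yg, pdx_eq_fderiv (hd p), pdy_eq_fderiv (hd p)]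
    rw [hXY]
    refine (Continuous.integrable_of_hasCompactSupport
      (((hfd _).pow 2).add ((continuous_fst.mul (hfd _)).pow 2)) ?_).integrableOn
    refine ((hζc i).fderiv (𝕜 := ℝ)).mono fun p hp => ?_
    contrapose! hp
    simp [Function.notMem_support.1 hp]
  have hmono : ∫ p in Ω, ∑ i, D i p ≤
      ∫ p in Ω, ((∑ i, (Xg (ζ i) p ^ 2 + Yg (ζ i) p ^ 2))
        + ∑ i, ∑ j, pdH (H j) i (fun k => u k p) * ζ i p * ζ j p) := by
    refine setIntegral_mono_on (integrable_finsetSum _ fun i _ => hDi i)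
      ((integrable_finsetSum _ fun i _ => hgrad i).add
        (integrable_finsetSum _ fun i _ => integrable_finsetSum _ fun j _ => hquad i j))
      hΩ.measurableSet fun p hp => ?_
    have hq := sum_sq_mul_inv_mul_sum_le (fun i j => pdH (H j) i (fun k => u k p))
      (fun i => ζ i p) (fun i => φ i p) (fun i j => hsymm i j _) (fun i => hφ0 i p hp)
      (fun i j hij => by simpa only [hsymm i j] using hneg i j hij p hp)
    refine (Finset.sum_le_sum fun i _ => hDle i p hp).trans ?_
    rw [Finset.sum_add_distrib]
    refine add_le_add le_rfl (le_trans (le_of_eq ?_) hq)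
    exact Finset.sum_congr rfl fun i _ => by simp only [hlin i p hp, hsymm i]
  rw [integral_add (integrable_finsetSum _ fun i _ => hgrad i)
      (integrable_finsetSum _ fun i _ => integrable_finsetSum _ fun j _ => hquad i j),
    integral_finsetSum _ fun i _ => hDi i, integral_finsetSum _ fun i _ => hgrad i,
    integral_finsetSum _ fun i _ => integrable_finsetSum _ fun j _ => hquad i j] at hmono
  simp only [hD0, Finset.sum_const_zero, integral_finsetSum _ fun j _ => hquad _ j] at hmono
  linarith
end

section
/- Let Ω ⊆ ℝ² be open and w ∈ C²(Ω). Then at every point p ∈ Ω where |∇_G w(p)| ≠ 0, the Sternberg–Zumbrun type identity holds: (XXw)² + (XYw)² + (YXw)² + (YYw)² − (X|∇_G w|)² − (Y|∇_G w|)² = |∇_G w|²·(𝒜(w)² + ℬ(w)²), where X|∇_G w| and Y|∇_G w| denote the Grushin vector fields applied to the function |∇_G w| (which is differentiable near p since it is positive there). -/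
open MeasureTheory Real Filter

/-- The `x`-partial derivative is the Fréchet derivative in the direction `(1, 0)`. -/
theorem pdx_eq_fderiv_s5 {u : ℝ × ℝ → ℝ} {q : ℝ × ℝ} (hu : DifferentiableAt ℝ u q) :
    pdx u q = fderiv ℝ u q (1, 0) := by
  have h : HasDerivAt (fun t : ℝ => (t, q.2)) ((1 : ℝ), (0 : ℝ)) q.1 :=
    (hasDerivAt_id q.1).prodMk (hasDerivAt_const q.1 q.2)
  exact (HasFDerivAt.comp_hasDerivAt (l := u) q.1 hu.hasFDerivAt h).deriv

/-- The `y`-partial derivative is the Fréchet derivative in the direction `(0, 1)`. -/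
theorem pdy_eq_fderiv_s5 {u : ℝ × ℝ → ℝ} {q : ℝ × ℝ} (hu : DifferentiableAt ℝ u q) :
    pdy u q = fderiv ℝ u q (0, 1) := by
  have h : HasDerivAt (fun t : ℝ => (q.1, t)) ((0 : ℝ), (1 : ℝ)) q.2 :=
    (hasDerivAt_const q.2 q.1).prodMk (hasDerivAt_id q.2)
  exact (HasFDerivAt.comp_hasDerivAt (l := u) q.2 hu.hasFDerivAt h).deriv

/-- The Fréchet derivative of a `C²` function is differentiable. -/
theorem ContDiffAt.differentiableAt_fderiv_two {u : ℝ × ℝ → ℝ} {p : ℝ × ℝ}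
    (hu : ContDiffAt ℝ 2 u p) : DifferentiableAt ℝ (fderiv ℝ u) p :=
  (hu.fderiv_right (m := 1) (by norm_num)).differentiableAt (by norm_num)

theorem ContDiffAt.eventually_differentiableAt_two {u : ℝ × ℝ → ℝ} {p : ℝ × ℝ}
    (hu : ContDiffAt ℝ 2 u p) : ∀ᶠ q in nhds p, DifferentiableAt ℝ u q :=
  (hu.eventually (by simp)).mono fun _ hq => hq.differentiableAt (by norm_num)

theorem ContDiffAt.differentiableAt_Xg {u : ℝ × ℝ → ℝ} {p : ℝ × ℝ}
    (hu : ContDiffAt ℝ 2 u p) : DifferentiableAt ℝ (Xg u) p := by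
  have h : DifferentiableAt ℝ (fun q => fderiv ℝ u q (1, 0)) p :=
    hu.differentiableAt_fderiv_two.clm_apply (differentiableAt_const _)
  exact h.congr_of_eventuallyEq
    (hu.eventually_differentiableAt_two.mono fun _ hq => pdx_eq_fderiv_s5 hq)

theorem ContDiffAt.differentiableAt_Yg {u : ℝ × ℝ → ℝ} {p : ℝ × ℝ}
    (hu : ContDiffAt ℝ 2 u p) : DifferentiableAt ℝ (Yg u) p := by
  have h : DifferentiableAt ℝ (fun q : ℝ × ℝ => q.1 * fderiv ℝ u q (0, 1)) p :=
    differentiableAt_fst.mul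
      (hu.differentiableAt_fderiv_two.clm_apply (differentiableAt_const _))
  exact h.congr_of_eventuallyEq
    (hu.eventually_differentiableAt_two.mono fun q hq => congrArg (q.1 * ·) (pdy_eq_fderiv_s5 hq))

/-- Derivative of the Grushin gradient norm, where it does not vanish. -/
theorem hasFDerivAt_normG {u : ℝ × ℝ → ℝ} {p : ℝ × ℝ} (hX : DifferentiableAt ℝ (Xg u) p)
    (hY : DifferentiableAt ℝ (Yg u) p) (hnz : normG u p ≠ 0) :
    HasFDerivAt (normG u) ((normG u p)⁻¹ •
      (Xg u p • fderiv ℝ (Xg u) p + Yg u p • fderiv ℝ (Yg u) p)) p := by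
  have hne : Xg u p ^ 2 + Yg u p ^ 2 ≠ 0 := fun h => hnz (by simp [normG, h])
  have h := ((hX.hasFDerivAt.pow 2).add (hY.hasFDerivAt.pow 2)).sqrt hne
  refine h.congr_fderiv ?_
  ext <;> simp [normG] <;> field_simp

/-- Rows of a `2 × 2` matrix decomposed along a vector `(a, b)` of length `n` and its normal. -/
theorem sternbergZumbrun_algebra {a b n r s t v : ℝ} (hn : n ≠ 0) (h : n ^ 2 = a ^ 2 + b ^ 2) :
    r ^ 2 + s ^ 2 + t ^ 2 + v ^ 2 - (n⁻¹ * (a * r + b * s)) ^ 2 - (n⁻¹ * (a * t + b * v)) ^ 2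
      = n ^ 2 * (((n ^ 3)⁻¹ * (r * b ^ 2 - s * a * b - t * a * b + v * a ^ 2)) ^ 2
        + ((n ^ 3)⁻¹ * (r * a * b - s * a ^ 2 + t * b ^ 2 - v * a * b)) ^ 2) := by
  have key : (r * b ^ 2 - s * a * b - t * a * b + v * a ^ 2) ^ 2
      + (r * a * b - s * a ^ 2 + t * b ^ 2 - v * a * b) ^ 2
      = n ^ 2 * ((r * b - s * a) ^ 2 + (t * b - v * a) ^ 2) := by
    rw [h]; ring
  have hr : n ^ 2 * (((n ^ 3)⁻¹ * (r * b ^ 2 - s * a * b - t * a * b + v * a ^ 2)) ^ 2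
        + ((n ^ 3)⁻¹ * (r * a * b - s * a ^ 2 + t * b ^ 2 - v * a * b)) ^ 2)
      = n ^ 2 * ((n ^ 3)⁻¹) ^ 2 * (n ^ 2 * ((r * b - s * a) ^ 2 + (t * b - v * a) ^ 2)) := by
    rw [← key]; ring
  rw [hr]
  field_simp
  rw [h]
  ring

/-- Sternberg–Zumbrun type identity for the Grushin vector fields at a
point where the Grushin gradient does not vanish. -/
theorem stmt_5 (Ω : Set (ℝ × ℝ)) (hΩ : IsOpen Ω)
    (w : ℝ × ℝ → ℝ) (hw : ContDiffOn ℝ 2 w Ω)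
    (p : ℝ × ℝ) (hp : p ∈ Ω) (hnz : normG w p ≠ 0) :
    (Xg (Xg w) p) ^ 2 + (Xg (Yg w) p) ^ 2 + (Yg (Xg w) p) ^ 2 + (Yg (Yg w) p) ^ 2
      - (Xg (normG w) p) ^ 2 - (Yg (normG w) p) ^ 2
      = (normG w p) ^ 2 * ((curvA w p) ^ 2 + (curvB w p) ^ 2) := by
  have hw' : ContDiffAt ℝ 2 w p := hw.contDiffAt (hΩ.mem_nhds hp)
  have hX := hw'.differentiableAt_Xg
  have hY := hw'.differentiableAt_Yg
  have hN := hasFDerivAt_normG hX hY hnz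
  have hXN : Xg (normG w) p
      = (normG w p)⁻¹ * (Xg w p * Xg (Xg w) p + Yg w p * Xg (Yg w) p) := by
    rw [Xg, Xg.eq_1 (Xg w), Xg.eq_1 (Yg w), pdx_eq_fderiv_s5 hN.differentiableAt,
      pdx_eq_fderiv_s5 hX, pdx_eq_fderiv_s5 hY, hN.fderiv]
    simp
    ring
  have hYN : Yg (normG w) p
      = (normG w p)⁻¹ * (Xg w p * Yg (Xg w) p + Yg w p * Yg (Yg w) p) := by
    rw [Yg, Yg.eq_1 (Xg w), Yg.eq_1 (Yg w), pdy_eq_fderiv_s5 hN.differentiableAt,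
      pdy_eq_fderiv_s5 hX, pdy_eq_fderiv_s5 hY, hN.fderiv]
    simp
    ring
  have hsq : normG w p ^ 2 = Xg w p ^ 2 + Yg w p ^ 2 := Real.sq_sqrt (by positivity)
  rw [hXN, hYN]
  exact sternbergZumbrun_algebra hnz hsq
end

section
/- Let m ≥ 1, let H̃ ∈ C¹(ℝ^m) with H_i = ∂_iH̃, let f_1,…,f_m : ℝ → ℝ be continuous, and let u_i ∈ C²(ℝ²) satisfy ∂_xx u_i(x,y) + f_i(x)²·∂_yy u_i(x,y) = H_i(u_1(x,y),…,u_m(x,y)) on ℝ². For R > 0 define I_R(y) = ∫_{−R}^{R} ( Σ_{i=1}^m ½·[(∂_x u_i(x,y))² − f_i(x)²·(∂_y u_i(x,y))²] + H̃(u(x,y)) ) dx. Assume that for every y ∈ ℝ the limit I(y) = lim_{R→∞} I_R(y) exists and is finite, and that there is a sequence R_k → ∞ such that for every y ∈ ℝ, Σ_{i=1}^m ∫_0^y [∂_x u_i(R_k,s)·∂_y u_i(R_k,s) − ∂_x u_i(−R_k,s)·∂_y u_i(−R_k,s)] ds → 0 as k → ∞. Then the Hamiltonian identity holds: I(y) =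 I(0) for every y ∈ ℝ. -/
open MeasureTheory Real Filter

theorem pdx_eq_fderiv_s7 {u : ℝ × ℝ → ℝ} (hu : Differentiable ℝ u) :
    pdx u = fun p => fderiv ℝ u p (1, 0) := by
  funext p
  have h : HasDerivAt (fun t : ℝ => (t, p.2)) ((1 : ℝ), (0 : ℝ)) p.1 :=
    (hasDerivAt_id p.1).prodMk (hasDerivAt_const p.1 p.2)
  exact ((hu (p.1, p.2)).hasFDerivAt.comp_hasDerivAt p.1 h).deriv

theorem pdy_eq_fderiv_s7 {u : ℝ × ℝ → ℝ} (hu : Differentiable ℝ u) :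
    pdy u = fun p => fderiv ℝ u p (0, 1) := by
  funext p
  have h : HasDerivAt (fun t : ℝ => (p.1, t)) ((0 : ℝ), (1 : ℝ)) p.2 :=
    (hasDerivAt_const p.2 p.1).prodMk (hasDerivAt_id p.2)
  exact ((hu (p.1, p.2)).hasFDerivAt.comp_hasDerivAt p.2 h).deriv

theorem hasDerivAt_pdx_s7 {u : ℝ × ℝ → ℝ} (hu : Differentiable ℝ u) (x y : ℝ) :
    HasDerivAt (fun t => u (t, y)) (pdx u (x, y)) x := by
  have h : Differentiable ℝ (fun t => u (t, y)) := by fun_prop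
  exact (h x).hasDerivAt

theorem hasDerivAt_pdy_s7 {u : ℝ × ℝ → ℝ} (hu : Differentiable ℝ u) (x y : ℝ) :
    HasDerivAt (fun t => u (x, t)) (pdy u (x, y)) y := by
  have h : Differentiable ℝ (fun t => u (x, t)) := by fun_prop
  exact (h y).hasDerivAt

theorem contDiff_pdx {u : ℝ × ℝ → ℝ} {m n : WithTop ℕ∞} (hu : ContDiff ℝ n u)
    (hmn : m + 1 ≤ n) : ContDiff ℝ m (pdx u) := by
  rw [pdx_eq_fderiv_s7 ((hu.of_le (le_add_self.trans hmn)).differentiable one_ne_zero)]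
  exact (hu.fderiv_right hmn).clm_apply contDiff_const

theorem contDiff_pdy {u : ℝ × ℝ → ℝ} {m n : WithTop ℕ∞} (hu : ContDiff ℝ n u)
    (hmn : m + 1 ≤ n) : ContDiff ℝ m (pdy u) := by
  rw [pdy_eq_fderiv_s7 ((hu.of_le (le_add_self.trans hmn)).differentiable one_ne_zero)]
  exact (hu.fderiv_right hmn).clm_apply contDiff_const

theorem pdy_pdx_eq_pdx_pdy {u : ℝ × ℝ → ℝ} (hu : ContDiff ℝ 2 u) :
    pdy (pdx u) = pdx (pdy u) := by
  have hd : Differentiable ℝ u := hu.differentiable two_ne_zero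
  have hx : Differentiable ℝ (pdx u) :=
    (contDiff_pdx (m := 1) hu (by norm_num)).differentiable one_ne_zero
  have hy : Differentiable ℝ (pdy u) :=
    (contDiff_pdy (m := 1) hu (by norm_num)).differentiable one_ne_zero
  have hdd : Differentiable ℝ (fderiv ℝ u) :=
    (hu.fderiv_right (m := 1) (by norm_num)).differentiable one_ne_zero
  rw [pdy_eq_fderiv_s7 hx, pdx_eq_fderiv_s7 hy, pdx_eq_fderiv_s7 hd, pdy_eq_fderiv_s7 hd]
  funext p
  have hsymm : IsSymmSndFDerivAt ℝ u p := hu.contDiffAt.isSymmSndFDerivAt (by simp)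
  rw [fderiv_clm_apply (hdd p) (by fun_prop), fderiv_clm_apply (hdd p) (by fun_prop)]
  simpa using hsymm (0, 1) (1, 0)

theorem fderiv_apply_eq_sum_pdH {m : ℕ} (H : (Fin m → ℝ) → ℝ) (v w : Fin m → ℝ) :
    fderiv ℝ H v w = ∑ i, pdH H i v * w i := by
  conv_lhs => rw [← Finset.univ_sum_single w, map_sum]
  refine Finset.sum_congr rfl fun i _ => ?_
  rw [pdH, mul_comm, ← smul_eq_mul, ← map_smul, ← Pi.single_smul, smul_eq_mul, mul_one]

/-- If `∂_y g = K = ∂ₓ F` with `K` continuous, then the integral of `g` over the horizontal segment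
`[a, b] × {y}` changes with `y` by the flux of `F` through the vertical sides. -/
theorem integral_sub_integral_eq_integral_flux {g F K : ℝ × ℝ → ℝ} (hg : Continuous g)
    (hK : Continuous K)
    (hgK : ∀ x y, HasDerivAt (fun t => g (x, t)) (K (x, y)) y)
    (hFK : ∀ x y, HasDerivAt (fun t => F (t, y)) (K (x, y)) x) (a b c d : ℝ) :
    (∫ x in a..b, g (x, d)) - ∫ x in a..b, g (x, c) =
      ∫ s in c..d, (F (b, s) - F (a, s)) := by
  have hcol : ∀ x, ∫ s in c..d, K (x, s) = g (x, d) - g (x, c) := fun x =>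
    intervalIntegral.integral_eq_sub_of_hasDerivAt (fun s _ => hgK x s)
      (Continuous.intervalIntegrable (by fun_prop) _ _)
  have hrow : ∀ s, ∫ x in a..b, K (x, s) = F (b, s) - F (a, s) := fun s =>
    intervalIntegral.integral_eq_sub_of_hasDerivAt (fun x _ => hFK x s)
      (Continuous.intervalIntegrable (by fun_prop) _ _)
  rw [← intervalIntegral.integral_sub (Continuous.intervalIntegrable (by fun_prop) _ _)
    (Continuous.intervalIntegrable (by fun_prop) _ _)]
  simp_rw [← hcol, ← hrow]
  refine intervalIntegral_intervalIntegral_swap (F := fun x s => K (x, s)) ?_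
  exact (hK.continuousOn.integrableOn_compact (isCompact_uIcc.prod isCompact_uIcc)).mono_set
    (Set.prod_mono Set.uIoc_subset_uIcc Set.uIoc_subset_uIcc)

/-- Hamiltonian identity for Grushin-type operators
`∂ₓₓ + f_i(x)²∂_yy` in two dimensions: under the stated convergence assumptions,
`I(y) = I(0)` for all `y`. -/
theorem stmt_7 {m : ℕ} (hm : 1 ≤ m)
    (Htil : (Fin m → ℝ) → ℝ) (hHtil : ContDiff ℝ 1 Htil)
    (H : Fin m → (Fin m → ℝ) → ℝ) (hHdef : ∀ i v, H i v = pdH Htil i v)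
    (f : Fin m → ℝ → ℝ) (hf : ∀ i, Continuous (f i))
    (u : Fin m → ℝ × ℝ → ℝ) (hu : ∀ i, ContDiff ℝ 2 (u i))
    (hsys : ∀ i p, pdx (pdx (u i)) p + (f i p.1) ^ 2 * pdy (pdy (u i)) p
      = H i (fun j => u j p))
    (IR : ℝ → ℝ → ℝ)
    (hIR : ∀ R y, IR R y = ∫ x in (-R)..R,
      ((∑ i, (1 / 2 : ℝ) * ((pdx (u i) (x, y)) ^ 2 - (f i x) ^ 2 * (pdy (u i) (x, y)) ^ 2))
        + Htil (fun i => u i (x, y))))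
    (I : ℝ → ℝ)
    (hI : ∀ y, Filter.Tendsto (fun R => IR R y) Filter.atTop (nhds (I y)))
    (Rk : ℕ → ℝ) (hRk : Filter.Tendsto Rk Filter.atTop Filter.atTop)
    (hbd : ∀ y, Filter.Tendsto (fun k => ∑ i, ∫ s in (0 : ℝ)..y,
      (pdx (u i) (Rk k, s) * pdy (u i) (Rk k, s)
        - pdx (u i) (-(Rk k), s) * pdy (u i) (-(Rk k), s)))
      Filter.atTop (nhds 0)) :
    ∀ y, I y = I 0 := by
  have hux : ∀ i, ContDiff ℝ 1 (pdx (u i)) := fun i => contDiff_pdx (hu i) (by norm_num)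
  have huy : ∀ i, ContDiff ℝ 1 (pdy (u i)) := fun i => contDiff_pdy (hu i) (by norm_num)
  have hud : ∀ i, Differentiable ℝ (u i) := fun i => (hu i).differentiable two_ne_zero
  have huxd : ∀ i, Differentiable ℝ (pdx (u i)) := fun i => (hux i).differentiable one_ne_zero
  have huyd : ∀ i, Differentiable ℝ (pdy (u i)) := fun i => (huy i).differentiable one_ne_zero
  have hucont : ∀ i, Continuous (u i) := fun i => (hu i).continuous
  have huxcont : ∀ i, Continuous (pdx (u i)) := fun i => (hux i).continuous
  have huycont : ∀ i, Continuous (pdy (u i)) := fun i => (huy i).continuous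
  have huxx : ∀ i, Continuous (pdx (pdx (u i))) := fun i =>
    (contDiff_pdx (m := 0) (hux i) (by norm_num)).continuous
  have huyx : ∀ i, Continuous (pdx (pdy (u i))) := fun i =>
    (contDiff_pdx (m := 0) (huy i) (by norm_num)).continuous
  have hHcont : Continuous Htil := hHtil.continuous
  let g : ℝ × ℝ → ℝ := fun p =>
    (∑ i, (1 / 2 : ℝ) * ((pdx (u i) p) ^ 2 - (f i p.1) ^ 2 * (pdy (u i) p) ^ 2))
      + Htil (fun i => u i p)
  let F : ℝ × ℝ → ℝ := fun p => ∑ i, pdx (u i) p * pdy (u i) p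
  let K : ℝ × ℝ → ℝ := fun p =>
    ∑ i, (pdx (pdx (u i)) p * pdy (u i) p + pdx (u i) p * pdx (pdy (u i)) p)
  have hg : Continuous g := by fun_prop
  have hK : Continuous K := by fun_prop
  have hFK : ∀ x y, HasDerivAt (fun t => F (t, y)) (K (x, y)) x := fun x y =>
    HasDerivAt.fun_sum fun i _ =>
      (hasDerivAt_pdx_s7 (huxd i) x y).mul (hasDerivAt_pdx_s7 (huyd i) x y)
  have hgK : ∀ x y, HasDerivAt (fun t => g (x, t)) (K (x, y)) y := by
    intro x y
    have hkin : ∀ i, HasDerivAt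
        (fun t => (1 / 2 : ℝ) * ((pdx (u i) (x, t)) ^ 2 - (f i x) ^ 2 * (pdy (u i) (x, t)) ^ 2))
        (pdx (u i) (x, y) * pdx (pdy (u i)) (x, y)
          - (f i x) ^ 2 * (pdy (u i) (x, y) * pdy (pdy (u i)) (x, y))) y := by
      intro i
      have hx := (hasDerivAt_pdy_s7 (huxd i) x y).pow 2
      have hy := ((hasDerivAt_pdy_s7 (huyd i) x y).pow 2).const_mul ((f i x) ^ 2)
      rw [pdy_pdx_eq_pdx_pdy (hu i)] at hx
      refine ((hx.sub hy).const_mul (1 / 2 : ℝ)).congr_deriv ?_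
      push_cast
      ring
    have hpot : HasDerivAt (fun t => Htil (fun i => u i (x, t)))
        (fderiv ℝ Htil (fun i => u i (x, y)) (fun i => pdy (u i) (x, y))) y :=
      ((hHtil.differentiable one_ne_zero) _).hasFDerivAt.comp_hasDerivAt y
        (hasDerivAt_pi.2 fun i => hasDerivAt_pdy_s7 (hud i) x y)
    refine ((HasDerivAt.fun_sum fun i _ => hkin i).add hpot).congr_deriv ?_
    rw [fderiv_apply_eq_sum_pdH, ← Finset.sum_add_distrib]
    refine Finset.sum_congr rfl fun i _ => ?_
    rw [← hHdef, ← hsys i (x, y)]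
    ring
  intro y
  have hflux : ∀ R, IR R y - IR R 0 = ∑ i, ∫ s in (0 : ℝ)..y,
      (pdx (u i) (R, s) * pdy (u i) (R, s) - pdx (u i) (-R, s) * pdy (u i) (-R, s)) := by
    intro R
    rw [hIR, hIR, ← intervalIntegral.integral_finsetSum
      fun i _ => Continuous.intervalIntegrable (by fun_prop) _ _]
    simp_rw [Finset.sum_sub_distrib]
    exact integral_sub_integral_eq_integral_flux hg hK hgK hFK (-R) R 0 y
  have hlim := ((hI y).comp hRk).sub ((hI 0).comp hRk)
  refine sub_eq_zero.1 (tendsto_nhds_unique hlim ((hbd y).congr fun k => ?_))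
  exact (hflux (Rk k)).symm
end
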